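/- arXiv:1404.4519 — 2 statements merged into one kernel-verified Lean document; each statement's English description precedes it below -/
import Mathlib

section
/- A reversible cellular automaton is chaotic in the sense of Devaney if and only if it is topologically transitive. Precisely: let S be a finite alphabet with at least two elements and let f : S^ℤ → S^ℤ be a bijective cellular automaton. Then f is Devaney chaotic (sensitive to initial conditions, topologically transitive, and has a dense set of periodic points) if and only if f is topologically transitive. -/
/-- The left shift map on two-sided configurations. -/
def shiftZ {S : Type*} (x : ℤ → S) : ℤ → S := fun n => x (n + 1)

/-- A cellular automaton: a continuous map commuting with the shift. -/
def IsCellularAutomaton {S : Type*} [TopologicalSpace S]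
    (f : (ℤ → S) → (ℤ → S)) : Prop :=
  Continuous f ∧ ∀ x, f (shiftZ x) = shiftZ (f x)

/-- Topological transitivity. -/
def IsTransitiveMap {S : Type*} [TopologicalSpace S]
    (f : (ℤ → S) → (ℤ → S)) : Prop :=
  ∀ U V : Set (ℤ → S), IsOpen U → IsOpen V → U.Nonempty → V.Nonempty →
    ∃ n : ℕ, (U ∩ f^[n] '' V).Nonempty

open Classical in
/-- The standard metric on configuration spaces. -/
noncomputable def caDist {S : Type*} (x y : ℤ → S) : ℝ :=
  if x = y then 0
  else (2 : ℝ) ^ (-((sInf {n : ℕ | ∃ i : ℤ, i.natAbs = n ∧ x i ≠ y i} : ℕ) : ℤ))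

/-- Sensitivity to initial conditions with respect to `caDist`. -/
def IsSensitiveMap {S : Type*} (f : (ℤ → S) → (ℤ → S)) : Prop :=
  ∃ ε : ℝ, 0 < ε ∧ ∀ x : ℤ → S, ∀ δ : ℝ, 0 < δ →
    ∃ (y : ℤ → S) (n : ℕ), caDist x y < δ ∧ ε ≤ caDist (f^[n] x) (f^[n] y)

/-- Density of periodic points. -/
def HasDensePeriodicPoints {S : Type*} [TopologicalSpace S]
    (f : (ℤ → S) → (ℤ → S)) : Prop :=
  Dense {x : ℤ → S | ∃ n : ℕ, 0 < n ∧ f^[n] x = x}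

/-- Devaney chaos: sensitive, transitive, dense periodic points. -/
def DevaneyChaotic {S : Type*} [TopologicalSpace S]
    (f : (ℤ → S) → (ℤ → S)) : Prop :=
  IsSensitiveMap f ∧ IsTransitiveMap f ∧ HasDensePeriodicPoints f


theorem IsCellularAutomaton.apply_translate {S : Type*} [TopologicalSpace S]
    {f : (ℤ → S) → (ℤ → S)} (hf : IsCellularAutomaton f) (k : ℤ) (x : ℤ → S) :
    f (fun i => x (i + k)) = fun i => f x (i + k) := by
  induction k using Int.induction_on generalizing x with
  | zero => simp
  | succ k ih =>
    have h := hf.2 (fun i => x (i + k))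
    rw [ih x] at h
    simp only [shiftZ, funext_iff] at h
    funext i
    rw [show i + ((k : ℤ) + 1) = i + 1 + k by ring, ← h i]
    congr 1
    funext j
    congr 1
    ring
  | pred k ih =>
    have h := hf.2 (fun i => x (i + (-(k : ℤ) - 1)))
    have e : shiftZ (fun i => x (i + (-(k : ℤ) - 1))) = fun i => x (i + -(k : ℤ)) := by
      funext j
      simp only [shiftZ]
      congr 1
      ring
    rw [e, ih x] at h
    funext i
    have h' := congrFun h (i - 1)
    simp only [shiftZ, sub_add_cancel] at h'
    rw [← h']
    congr 1
    ring

theorem IsCellularAutomaton.iterate {S : Type*} [TopologicalSpace S]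
    {f : (ℤ → S) → (ℤ → S)} (hf : IsCellularAutomaton f) (n : ℕ) :
    IsCellularAutomaton f^[n] :=
  ⟨hf.1.iterate n, Function.Commute.iterate_left (f := f) (g := shiftZ) hf.2 n⟩

theorem exists_forall_natAbs_le_imp_mem {S : Type*} [TopologicalSpace S] {U : Set (ℤ → S)}
    (hU : IsOpen U) {x : ℤ → S} (hx : x ∈ U) :
    ∃ m : ℕ, ∀ y : ℤ → S, (∀ i : ℤ, i.natAbs ≤ m → y i = x i) → y ∈ U := by
  obtain ⟨I, u, hu, hIU⟩ := isOpen_pi_iff.1 hU x hx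
  refine ⟨I.sup Int.natAbs, fun y hy => hIU fun i hi => ?_⟩
  rw [hy i (Finset.le_sup (f := Int.natAbs) hi)]
  exact (hu i hi).2

theorem isOpen_setOf_forall_natAbs_le {S : Type*} [TopologicalSpace S] [DiscreteTopology S]
    (x : ℤ → S) (m : ℕ) : IsOpen {y : ℤ → S | ∀ i : ℤ, i.natAbs ≤ m → y i = x i} := by
  have : {y : ℤ → S | ∀ i : ℤ, i.natAbs ≤ m → y i = x i} =
      (Set.Icc (-m : ℤ) m).pi fun i => {x i} := by
    ext y
    simp only [Set.mem_ofPred_eq, Set.mem_pi, Set.mem_Icc, Set.mem_singleton_iff]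
    exact forall_congr' fun i => ⟨fun h hi => h (by omega), fun h hi => h (by omega)⟩
  rw [this]
  exact isOpen_set_pi (Set.finite_Icc _ _) fun i _ => isOpen_discrete _

theorem caDist_le_of_forall_natAbs_le {S : Type*} {x y : ℤ → S} {m : ℕ}
    (h : ∀ i : ℤ, i.natAbs ≤ m → y i = x i) : caDist x y ≤ (2 : ℝ) ^ (-(m : ℤ)) := by
  unfold caDist
  split_ifs with hxy
  · positivity
  · obtain ⟨i, hi⟩ := Function.ne_iff.1 hxy
    refine zpow_le_zpow_right₀ one_le_two (neg_le_neg (Int.ofNat_le.2 ?_))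
    refine le_csInf ⟨i.natAbs, i, rfl, hi⟩ ?_
    rintro _ ⟨j, rfl, hj⟩
    by_contra! hlt
    exact hj (h j hlt.le).symm

theorem one_le_caDist_of_apply_zero_ne {S : Type*} {x y : ℤ → S} (h : x 0 ≠ y 0) :
    1 ≤ caDist x y := by
  have hxy : x ≠ y := fun e => h (congrFun e 0)
  have h0 : sInf {n : ℕ | ∃ i : ℤ, i.natAbs = n ∧ x i ≠ y i} = 0 :=
    Nat.sInf_eq_zero.2 (Or.inl ⟨0, rfl, h⟩)
  simp [caDist, hxy, h0]

theorem finite_setOf_forall_apply_add_eq {S : Type*} [Finite S] {q : ℤ} (hq : 0 < q) :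
    {x : ℤ → S | ∀ i, x (i + q) = x i}.Finite := by
  refine Set.Finite.of_injOn (f := fun (x : ℤ → S) (i : Set.Ico 0 q) => x i)
    (Set.mapsTo_univ _ _) ?_ Set.finite_univ
  intro x hx y hy hxy
  funext i
  have hmod : i % q ∈ Set.Ico 0 q := ⟨Int.emod_nonneg _ hq.ne', Int.emod_lt_of_pos _ hq⟩
  have hred {z : ℤ → S} (hz : Function.Periodic z q) : z (i % q) = z i := by
    rw [Int.emod_def, mul_comm]
    exact hz.sub_int_mul_eq (i / q)
  rw [← hred hx, ← hred hy]
  exact congrFun hxy ⟨i % q, hmod⟩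

theorem IsCellularAutomaton.hasDensePeriodicPoints {S : Type*} [Finite S] [TopologicalSpace S]
    {f : (ℤ → S) → (ℤ → S)} (hf : IsCellularAutomaton f) (hinj : Function.Injective f) :
    HasDensePeriodicPoints f := by
  refine dense_iff_inter_open.2 fun U hU ⟨x, hx⟩ => ?_
  obtain ⟨m, hm⟩ := exists_forall_natAbs_le_imp_mem hU hx
  set q : ℤ := 2 * m + 1
  let y : ℤ → S := fun i => x ((i + m) % q - m)
  have hy : ∀ i, y (i + q) = y i := fun i => by
    simp only [y]
    rw [add_right_comm, Int.add_emod_right]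
  refine ⟨y, hm y fun i hi => ?_, ?_⟩
  · simp only [y]
    rw [Int.emod_eq_of_lt (by omega) (by omega), add_sub_cancel_right]
  · have horbit : ∀ n : ℕ, f^[n] y ∈ {z : ℤ → S | ∀ i, z (i + q) = z i} := fun n i => by
      have h := (hf.iterate n).apply_translate q y
      rw [funext hy] at h
      exact (congrFun h i).symm
    obtain ⟨a, b, hab, heq⟩ := Set.Finite.exists_lt_map_eq_of_forall_mem horbit
      (finite_setOf_forall_apply_add_eq (by omega))
    refine ⟨b - a, by omega, hinj.iterate a ?_⟩
    rw [← Function.iterate_add_apply, Nat.add_sub_cancel' hab.le, heq]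

theorem IsTransitiveMap.iterate_ne_id {S : Type*} [TopologicalSpace S] [T2Space S] [Nontrivial S]
    {f : (ℤ → S) → (ℤ → S)} (hc : Continuous f) (ht : IsTransitiveMap f) {p : ℕ} (hp : 0 < p) :
    f^[p] ≠ id := by
  intro hid
  obtain ⟨x⟩ : Nonempty (ℤ → S) := inferInstance
  have hfin : ((fun i => f^[i] x) '' Set.Iio p).Finite := (Set.finite_Iio p).image _
  obtain ⟨y, hy⟩ := hfin.infinite_compl.nonempty
  obtain ⟨W, U, hW, hU, hxW, hyU, hWU⟩ := SeparatedNhds.of_isCompact_isCompact hfin.isCompact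
    (isCompact_singleton (x := y)) (Set.disjoint_singleton_right.2 hy)
  obtain ⟨n, z, hzU, v, hv, rfl⟩ := ht U (⋂ i ∈ Set.Iio p, f^[i] ⁻¹' W) hU
    ((Set.finite_Iio p).isOpen_biInter fun i _ => hW.preimage (hc.iterate i))
    ⟨y, hyU rfl⟩ ⟨x, Set.mem_iInter₂.2 fun i hi => hxW ⟨i, hi, rfl⟩⟩
  have hper : Function.IsPeriodicPt f p v := congrFun hid v
  have hmem := Set.mem_iInter₂.1 hv (n % p) (Nat.mod_lt n hp)
  rw [Set.mem_preimage, hper.iterate_mod_apply] at hmem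
  exact Set.disjoint_left.1 hWU hmem hzU

theorem IsCellularAutomaton.isSensitiveMap {S : Type*} [TopologicalSpace S] [DiscreteTopology S]
    [Nontrivial S] {f : (ℤ → S) → (ℤ → S)} (hf : IsCellularAutomaton f)
    (ht : IsTransitiveMap f) (hd : HasDensePeriodicPoints f) : IsSensitiveMap f := by
  refine ⟨1, one_pos, ?_⟩
  by_contra! hns
  obtain ⟨x, δ, hδ, hx⟩ := hns
  obtain ⟨m, hm⟩ := exists_pow_lt_of_lt_one hδ (show (2⁻¹ : ℝ) < 1 by norm_num)
  set C := {y : ℤ → S | ∀ i : ℤ, i.natAbs ≤ m → y i = x i}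
  have hC : IsOpen C := isOpen_setOf_forall_natAbs_le x m
  have hxC : x ∈ C := fun _ _ => rfl
  have htrace : ∀ y ∈ C, ∀ n : ℕ, f^[n] y 0 = f^[n] x 0 := fun y hy n => by
    by_contra hne
    refine (hx y n (lt_of_le_of_lt (caDist_le_of_forall_natAbs_le hy) ?_)).not_ge
      (one_le_caDist_of_apply_zero_ne (Ne.symm hne))
    rwa [zpow_neg, zpow_natCast, ← inv_pow]
  obtain ⟨w, hwC, p, hp, hwp⟩ := hd.inter_open_nonempty C hC ⟨x, hxC⟩
  have hdense : Dense {u : ℤ → S | f^[p] u 0 = u 0} := by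
    refine dense_iff_inter_open.2 fun U hU hne => ?_
    obtain ⟨n, u, huU, v, hv, rfl⟩ := ht U C hU hC hne ⟨x, hxC⟩
    refine ⟨_, huU, ?_⟩
    rw [Set.mem_ofPred_eq, ← Function.iterate_add_apply, htrace v hv, htrace v hv,
      ← htrace w hwC, ← htrace w hwC, add_comm, Function.iterate_add_apply, hwp]
  have hzero : ∀ u : ℤ → S, f^[p] u 0 = u 0 := fun u =>
    congrFun (Continuous.ext_on hdense ((continuous_apply 0).comp (hf.1.iterate p))
      (continuous_apply 0) fun _ hu => hu) u
  refine ht.iterate_ne_id hf.1 hp (funext fun u => funext fun k => ?_)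
  have h := hzero fun i => u (i + k)
  simpa only [(hf.iterate p).apply_translate, zero_add, id] using h

/-- A reversible (bijective) cellular automaton on a finite alphabet with at least
two letters is Devaney chaotic if and only if it is topologically transitive. -/
theorem stmt_0 {S : Type*} [Fintype S] [TopologicalSpace S] [DiscreteTopology S]
    (hS : 1 < Fintype.card S) (f : (ℤ → S) → (ℤ → S))
    (hca : IsCellularAutomaton f) (hbij : Function.Bijective f) :
    DevaneyChaotic f ↔ IsTransitiveMap f := by
  have : Nontrivial S := Fintype.one_lt_card_iff_nontrivial.1 hS
  have hd := hca.hasDensePeriodicPoints hbij.injective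
  exact ⟨fun h => h.2.1, fun ht => ⟨hca.isSensitiveMap ht hd, ht, hd⟩⟩
end

section
/- Every topologically transitive reversible cellular automaton has a dense set of periodic points. Precisely: let S be a finite alphabet and let f : S^ℤ → S^ℤ be a bijective cellular automaton that is topologically transitive. Then the set of points x ∈ S^ℤ with f^n(x) = x for some n ≥ 1 is dense in S^ℤ. -/
theorem IsCellularAutomaton.iterate_shiftZ {S : Type*} [TopologicalSpace S]
    {f : (ℤ → S) → (ℤ → S)} (hf : IsCellularAutomaton f) (p : ℕ) (x : ℤ → S) :
    f (shiftZ^[p] x) = shiftZ^[p] (f x) :=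
  (Function.Commute.iterate_right (g := shiftZ) hf.2 p) x

theorem iterate_shiftZ_apply {S : Type*} (p : ℕ) (x : ℤ → S) (n : ℤ) :
    shiftZ^[p] x n = x (n + p) := by
  induction p generalizing x with
  | zero => simp
  | succ p ih =>
    rw [Function.iterate_succ_apply, ih, shiftZ]
    push_cast
    rw [add_assoc]

/-- A configuration of spatial period `p` is determined by its values on `[0, p)`. -/
theorem finite_setOf_iterate_shiftZ_eq {S : Type*} [Finite S] {p : ℕ} (hp : 0 < p) :
    {x : ℤ → S | shiftZ^[p] x = x}.Finite := by
  let r : (ℤ → S) → (Fin p → S) := fun x i => x (i : ℕ)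
  refine Set.Finite.of_finite_image (f := r) (Set.toFinite _) fun x hx y hy hxy => ?_
  have hp' : (0 : ℤ) < p := by exact_mod_cast hp
  have periodic {z : ℤ → S} (hz : shiftZ^[p] z = z) : Function.Periodic z (p : ℤ) := fun n => by
    rw [← iterate_shiftZ_apply p z, hz]
  have emod {z : ℤ → S} (hz : shiftZ^[p] z = z) (n : ℤ) : z (n % p) = z n := by
    rw [Int.emod_def, mul_comm]
    exact (periodic hz).sub_int_mul_eq (n / p)
  funext n
  rw [← emod hx n, ← emod hy n]
  have hlt := Int.emod_lt_of_pos n hp'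
  have hnonneg := Int.emod_nonneg n hp'.ne'
  have h := congrFun hxy ⟨(n % p).toNat, by omega⟩
  simpa [r, Int.toNat_of_nonneg hnonneg] using h

/-- Spatially periodic configurations are temporally periodic for an injective cellular automaton:
it restricts to an injective self-map of a finite set. -/
theorem IsCellularAutomaton.mem_periodicPts {S : Type*} [Finite S] [TopologicalSpace S]
    {f : (ℤ → S) → (ℤ → S)} (hf : IsCellularAutomaton f) (hinj : Function.Injective f)
    {p : ℕ} (hp : 0 < p) {x : ℤ → S} (hx : shiftZ^[p] x = x) :
    x ∈ Function.periodicPts f := by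
  have hfin := finite_setOf_iterate_shiftZ_eq (S := S) hp
  have hmaps : Set.MapsTo f {x : ℤ → S | shiftZ^[p] x = x} {x | shiftZ^[p] x = x} := fun y hy => by
    rw [Set.mem_ofPred_eq, ← hf.iterate_shiftZ, hy]
  obtain ⟨m, -, n, -, hmn, heq⟩ := Set.infinite_univ.exists_ne_map_eq_of_mapsTo
    (f := fun n : ℕ => f^[n] x) (fun n _ => hmaps.iterate n hx) hfin
  wlog hlt : m < n generalizing m n
  · exact this n m hmn.symm heq.symm (by omega)
  refine Function.mk_mem_periodicPts (Nat.sub_pos_of_lt hlt) (hinj.iterate m ?_)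
  rw [← Function.iterate_add_apply, Nat.add_sub_cancel' hlt.le]
  exact heq.symm

/-- Spatially periodic configurations are dense. -/
theorem dense_setOf_exists_iterate_shiftZ_eq (S : Type*) [TopologicalSpace S] :
    Dense {x : ℤ → S | ∃ p : ℕ, 0 < p ∧ shiftZ^[p] x = x} := by
  intro x
  let y : ℕ → ℤ → S := fun k n => x ((n + k) % (2 * k + 1) - k)
  have hy : Filter.Tendsto y Filter.atTop (nhds x) := by
    refine tendsto_pi_nhds.2 fun n => tendsto_const_nhds.congr' ?_
    filter_upwards [Filter.eventually_ge_atTop n.natAbs] with k hk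
    have h : (n + k) % (2 * k + 1 : ℤ) = n + k := Int.emod_eq_of_lt (by omega) (by omega)
    simp only [y, h, add_sub_cancel_right]
  refine mem_closure_of_tendsto hy (Filter.Eventually.of_forall fun k => ⟨2 * k + 1, by omega, ?_⟩)
  funext n
  rw [iterate_shiftZ_apply]
  simp only [y]
  push_cast
  rw [add_right_comm, Int.add_emod_right]

/-- Every topologically transitive reversible (bijective) cellular automaton on a
finite alphabet has a dense set of periodic points. -/
theorem stmt_1 {S : Type*} [Fintype S] [TopologicalSpace S] [DiscreteTopology S]
    (f : (ℤ → S) → (ℤ → S))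
    (hca : IsCellularAutomaton f) (hbij : Function.Bijective f)
    (htrans : IsTransitiveMap f) :
    Dense {x : ℤ → S | ∃ n : ℕ, 0 < n ∧ f^[n] x = x} := by
  exact (dense_setOf_exists_iterate_shiftZ_eq S).mono
    fun x (hx : ∃ p : ℕ, 0 < p ∧ shiftZ^[p] x = x) =>
      let ⟨_, hp, hpx⟩ := hx
      hca.mem_periodicPts hbij.injective hp hpx
end
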